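/- Let μ be a probability measure on ℝ with support contained in [−R, R] (R > 0). Let F and G be the cumulative distribution functions of the standard Gaussian γ_1 and of μ*γ_1 respectively. Then for all x with −2R ≤ x ≤ 2R, the derivative of G⁻¹∘F satisfies (G⁻¹∘F)'(x) ≤ e^{12R²}. -/

import Mathlib

open MeasureTheory Real Filter

/-- The standard Gaussian density `p(t) = (2π)^{-1/2} exp(−t²/2)`. -/
noncomputable def stdp (t : ℝ) : ℝ := (2 * π) ^ (-(1 : ℝ) / 2) * Real.exp (-t ^ 2 / 2)

/-- `q(t) = ∫_{[−R,R]} p(t−s) dμ(s)`, the density of `μ ∗ γ₁`. -/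
noncomputable def qdens (μ : Measure ℝ) (R : ℝ) (t : ℝ) : ℝ :=
  ∫ s in Set.Icc (-R) R, stdp (t - s) ∂μ

/-- `Λ(x) = ∫_{[−R,R]} e^{xs} dμ(s)`. -/
noncomputable def Lam (μ : Measure ℝ) (R : ℝ) (x : ℝ) : ℝ :=
  ∫ s in Set.Icc (-R) R, Real.exp (x * s) ∂μ

/-- `K(x) = (log Λ(x) + R) / x`. -/
noncomputable def Kfun (μ : Measure ℝ) (R : ℝ) (x : ℝ) : ℝ :=
  (Real.log (Lam μ R x) + R) / x

/-- `F`, the cumulative distribution function of the standard Gaussian `γ₁`. -/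
noncomputable def Fcdf (x : ℝ) : ℝ := ∫ t in Set.Iic x, stdp t

/-- `G`, the cumulative distribution function of `μ ∗ γ₁`. -/
noncomputable def Gcdf (μ : Measure ℝ) (R : ℝ) (x : ℝ) : ℝ :=
  ∫ t in Set.Iic x, qdens μ R t


lemma stdp_cont : Continuous stdp := by
  unfold stdp; fun_prop

lemma stdp_pos (t : ℝ) : 0 < stdp t := by
  unfold stdp; positivity

lemma stdp_integrable : Integrable stdp := by
  have h := (integrable_exp_neg_mul_sq (b := 1 / 2) (by norm_num)).const_mul
    ((2 * π) ^ (-(1 : ℝ) / 2))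
  refine h.congr (Eventually.of_forall fun t => ?_)
  simp only [stdp]
  congr 2
  ring

lemma stdp_le (t : ℝ) : stdp t ≤ (2 * π) ^ (-(1 : ℝ) / 2) := by
  unfold stdp
  have h : Real.exp (-t ^ 2 / 2) ≤ 1 := Real.exp_le_one_iff.2 (by nlinarith [sq_nonneg t])
  have h2 : (0 : ℝ) ≤ (2 * π) ^ (-(1 : ℝ) / 2) := by positivity
  nlinarith

lemma Fcdf_strictMono : StrictMono Fcdf := by
  intro a b hab
  have h := intervalIntegral.integral_Iic_sub_Iic (μ := volume) (f := stdp) (a := a) (b := b)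
    stdp_integrable.integrableOn stdp_integrable.integrableOn
  have h2 := intervalIntegral.intervalIntegral_pos_of_pos
    (stdp_cont.intervalIntegrable (μ := volume) a b) stdp_pos hab
  unfold Fcdf
  linarith

lemma Iic_hasDerivAt (f : ℝ → ℝ) (hf : Continuous f) (hi : Integrable f) (x : ℝ) :
    HasDerivAt (fun y => ∫ t in Set.Iic y, f t) (f x) x := by
  have h := intervalIntegral.integral_hasDerivAt_right (hf.intervalIntegrable (μ := volume) x x)
    (hf.stronglyMeasurableAtFilter _ _) hf.continuousAt
  have h2 := h.add_const (∫ t in Set.Iic x, f t)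
  refine h2.congr_of_eventuallyEq (Eventually.of_forall fun y => ?_)
  have h3 := intervalIntegral.integral_Iic_sub_Iic (μ := volume) (f := f) (a := x) (b := y)
    hi.integrableOn hi.integrableOn
  show _ = _ + _
  linarith

lemma stdp_prod_integrable (μ : Measure ℝ) [IsProbabilityMeasure μ] :
    Integrable (fun z : ℝ × ℝ => stdp (z.1 - z.2)) (volume.prod μ) := by
  have hc : Continuous (fun z : ℝ × ℝ => stdp (z.1 - z.2)) :=
    stdp_cont.comp (continuous_fst.sub continuous_snd)
  rw [integrable_prod_iff' hc.aestronglyMeasurable]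
  refine ⟨Eventually.of_forall fun s => stdp_integrable.comp_sub_right s, ?_⟩
  have : (fun s : ℝ => ∫ t : ℝ, ‖stdp (t - s)‖) = fun _ => ∫ t : ℝ, ‖stdp t‖ := by
    funext s
    exact integral_sub_right_eq_self (fun t => ‖stdp t‖) s
  simp only [this]
  exact integrable_const _

lemma Fcdf_shift (y s : ℝ) : ∫ t in Set.Iic y, stdp (t - s) = Fcdf (y - s) := by
  have h := (measurePreserving_sub_right (volume : Measure ℝ) s).setIntegral_preimage_emb
    (measurableEmbedding_subRight s) stdp (Set.Iic (y - s))
  rw [Fcdf, ← h]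
  congr 2
  ext t
  simp

lemma stdp_shift_integrable (μ : Measure ℝ) [IsProbabilityMeasure μ] (t : ℝ) :
    Integrable (fun s => stdp (t - s)) μ := by
  refine Integrable.of_bound (C := (2 * π) ^ (-(1 : ℝ) / 2)) ?_ (Eventually.of_forall fun s => ?_)
  · exact (stdp_cont.comp (continuous_const.sub continuous_id)).aestronglyMeasurable
  · rw [Real.norm_of_nonneg (stdp_pos _).le]; exact stdp_le _

lemma stdp_ratio (R x y s : ℝ) (hx1 : -(2 * R) ≤ x) (hx2 : x ≤ 2 * R)
    (h1 : x - R ≤ y) (h2 : y ≤ x + R) (h3 : -R ≤ s) (h4 : s ≤ R) :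
    stdp x * Real.exp (-(12 * R ^ 2)) ≤ stdp (y - s) := by
  unfold stdp
  rw [mul_assoc, ← Real.exp_add]
  have : (y - s) ^ 2 ≤ x ^ 2 + 12 * R ^ 2 := by
    have e : (y - s) ^ 2 = x ^ 2 + 2 * x * (y - s - x) + (y - s - x) ^ 2 := by ring
    have e1 : (y - s - x) ^ 2 ≤ (2 * R) ^ 2 := sq_le_sq' (by linarith) (by linarith)
    have e2 : x * (y - s - x) ≤ (2 * R) * (2 * R) := by
      nlinarith [sq_nonneg (x - (y - s - x)),
        sq_le_sq' (show -(2 * R) ≤ x by linarith) (show x ≤ 2 * R by linarith)]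
    nlinarith
  gcongr
  nlinarith [sq_nonneg R]

theorem stmt14 (μ : Measure ℝ) [IsProbabilityMeasure μ] (R : ℝ) (hR : 0 < R)
    (hsupp : μ (Set.Icc (-R) R)ᶜ = 0)
    (H : ℝ → ℝ) (hH : ∀ x, Gcdf μ R (H x) = Fcdf x) :
    ∀ x : ℝ, -(2 * R) ≤ x → x ≤ 2 * R → deriv H x ≤ Real.exp (12 * R ^ 2) := by
  intro x hx1 hx2
  have hae : ∀ᵐ s ∂μ, s ∈ Set.Icc (-R) R := by
    rw [ae_iff]; exact hsupp
  have hres : μ.restrict (Set.Icc (-R) R) = μ := Measure.restrict_eq_self_of_ae_mem hae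
  have hq : qdens μ R = fun t => ∫ s, stdp (t - s) ∂μ := by
    funext t; rw [qdens, hres]
  have hqi : Integrable (qdens μ R) := by
    rw [hq]; exact (stdp_prod_integrable μ).integral_prod_left
  have hqc : Continuous (qdens μ R) := by
    rw [hq]
    refine continuous_of_dominated (bound := fun _ => (2 * π) ^ (-(1 : ℝ) / 2))
      (fun t => (stdp_shift_integrable μ t).aestronglyMeasurable)
      (fun t => Eventually.of_forall fun s => ?_) (integrable_const _)
      (Eventually.of_forall fun s => stdp_cont.comp (continuous_id.sub continuous_const))
    rw [Real.norm_of_nonneg (stdp_pos _).le]; exact stdp_le _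
  have hfub : ∀ y, Integrable (fun s => Fcdf (y - s)) μ ∧
      Gcdf μ R y = ∫ s, Fcdf (y - s) ∂μ := by
    intro y
    have hi : Integrable (fun z : ℝ × ℝ => stdp (z.1 - z.2))
        ((volume.restrict (Set.Iic y)).prod μ) :=
      (stdp_prod_integrable μ).mono_measure
        (Measure.prod_mono Measure.restrict_le_self le_rfl)
    constructor
    · have := hi.integral_prod_right
      simpa only [Fcdf_shift] using this
    · rw [Gcdf, hq, integral_integral_swap (f := fun t s => stdp (t - s)) hi]
      simp only [Fcdf_shift]
  obtain ⟨hi, hG⟩ := hfub (H x)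
  rw [hH] at hG
  have h2 : H x ≤ x + R := by
    have h : Fcdf (H x - R) ≤ Fcdf x := by
      rw [hG]
      calc Fcdf (H x - R) = ∫ s, Fcdf (H x - R) ∂μ := by simp
        _ ≤ _ := integral_mono_ae (integrable_const _) hi (by
          filter_upwards [hae] with s hs
          exact Fcdf_strictMono.monotone (by linarith [hs.2]))
    have := Fcdf_strictMono.le_iff_le.1 h
    linarith
  have h1 : x - R ≤ H x := by
    have h : Fcdf x ≤ Fcdf (H x + R) := by
      rw [hG]
      calc _ ≤ ∫ s, Fcdf (H x + R) ∂μ := integral_mono_ae hi (integrable_const _) (by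
            filter_upwards [hae] with s hs
            exact Fcdf_strictMono.monotone (by linarith [hs.1]))
        _ = _ := by simp
    have := Fcdf_strictMono.le_iff_le.1 h
    linarith
  have hlow : stdp x * Real.exp (-(12 * R ^ 2)) ≤ qdens μ R (H x) := by
    rw [hq]
    calc _ = ∫ s, stdp x * Real.exp (-(12 * R ^ 2)) ∂μ := by simp
      _ ≤ _ := integral_mono_ae (integrable_const _) (stdp_shift_integrable μ _) (by
          filter_upwards [hae] with s hs
          exact stdp_ratio R x (H x) s hx1 hx2 h1 h2 hs.1 hs.2)
  by_cases hd : DifferentiableAt ℝ H x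
  · have hc : HasDerivAt (fun x => Gcdf μ R (H x)) (qdens μ R (H x) * deriv H x) x :=
      (Iic_hasDerivAt (qdens μ R) hqc hqi (H x)).comp x hd.hasDerivAt
    have hF : HasDerivAt (fun x => Gcdf μ R (H x)) (stdp x) x := by
      rw [funext hH]
      exact Iic_hasDerivAt stdp stdp_cont stdp_integrable x
    have he := hc.unique hF
    by_contra! hlt
    have hp := stdp_pos x
    have hE := Real.exp_pos (-(12 * R ^ 2))
    have hqp : 0 < qdens μ R (H x) := lt_of_lt_of_le (by positivity) hlow
    have hEE : Real.exp (-(12 * R ^ 2)) * Real.exp (12 * R ^ 2) = 1 := by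
      rw [← Real.exp_add]; simp
    have a1 : qdens μ R (H x) * Real.exp (12 * R ^ 2) < stdp x := by
      rw [← he]; exact mul_lt_mul_of_pos_left hlt hqp
    have a2 := mul_le_mul_of_nonneg_right hlow (Real.exp_pos (12 * R ^ 2)).le
    rw [mul_assoc, hEE] at a2
    linarith
  · rw [deriv_zero_of_not_differentiableAt hd]
    exact (Real.exp_pos _).le
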